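/- arXiv:cs/0602091 — 2 statements merged into one kernel-verified Lean document; each statement's English description precedes it below -/
import Mathlib

section
/- Let K_Z be an n×n symmetric positive definite real matrix and P > 0. Let K_V be symmetric positive semidefinite and B strictly lower triangular with tr(K_V + B K_Z Bᵀ) ≤ nP, and set K_Y = K_V + (I+B) K_Z (I+B)ᵀ. Then (K_V, B) attains the maximum of log det(K_V' + (I+B') K_Z (I+B')ᵀ) over all symmetric positive semidefinite K_V' and strictly lower triangular B' with tr(K_V' + B' K_Z B'ᵀ) ≤ nP if and only if all three of the following hold: (i) Power: tr(K_V + B K_Z Bᵀ) = nP; (ii) Water-filling: tr(K_V (K_Y - λ_min(K_Y) I)) = 0; (iii) Orthogonality: K_V + B K_Z (I+B)ᵀ is upper triangular. -/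
open MeasureTheory Real Filter Matrix

noncomputable section

/-- The smallest eigenvalue of a (symmetric) real matrix. -/
def lambdaMin {n : ℕ} (M : Matrix (Fin n) (Fin n) ℝ) : ℝ :=
  sInf {t : ℝ | ∃ v : Fin n → ℝ, v ≠ 0 ∧ M.mulVec v = t • v}

open scoped MatrixOrder in
lemma psd_factor {n : ℕ} {A : Matrix (Fin n) (Fin n) ℝ} (hA : A.PosSemidef) :
    ∃ R : Matrix (Fin n) (Fin n) ℝ, A = Rᵀ * R := by
  obtain ⟨R, hR⟩ := CStarAlgebra.nonneg_iff_eq_star_mul_self.mp hA.nonneg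
  exact ⟨R, by rw [hR, star_eq_conjTranspose, conjTranspose_eq_transpose_of_trivial]⟩

lemma psd_conj {n : ℕ} {A : Matrix (Fin n) (Fin n) ℝ} (hA : A.PosSemidef)
    (R : Matrix (Fin n) (Fin n) ℝ) : (R * A * Rᵀ).PosSemidef := by
  simpa [conjTranspose_eq_transpose_of_trivial] using hA.mul_mul_conjTranspose_same R

lemma pd_conj {n : ℕ} {A : Matrix (Fin n) (Fin n) ℝ} (hA : A.PosDef)
    (R : Matrix (Fin n) (Fin n) ℝ) (hR : R.det ≠ 0) : (R * A * Rᵀ).PosDef := by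
  rw [(psd_conj hA.posSemidef R).posDef_iff_det_ne_zero]
  simp [det_mul, hR, hA.det_pos.ne']

lemma psd_symm {n : ℕ} {A : Matrix (Fin n) (Fin n) ℝ} (hA : A.IsHermitian) : Aᵀ = A := by
  rw [← conjTranspose_eq_transpose_of_trivial]; exact hA.eq

lemma trace_psd_mul {n : ℕ} {A C : Matrix (Fin n) (Fin n) ℝ} (hA : A.PosSemidef)
    (hC : C.PosSemidef) : 0 ≤ (A * C).trace := by
  obtain ⟨R, rfl⟩ := psd_factor hA
  rw [← trace_mul_cycle]
  exact (psd_conj hC R).trace_nonneg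

lemma trace_psd_mul_zero {n : ℕ} {A C : Matrix (Fin n) (Fin n) ℝ} (hA : A.PosSemidef)
    (hC : C.PosSemidef) (h : (A * C).trace = 0) : A * C = 0 := by
  obtain ⟨R, rfl⟩ := psd_factor hA
  rw [← trace_mul_cycle, (psd_conj hC R).trace_eq_zero_iff] at h
  obtain ⟨Q, rfl⟩ := psd_factor hC
  have h2 : Q * Rᵀ = 0 := by
    rw [← conjTranspose_mul_self_eq_zero, conjTranspose_eq_transpose_of_trivial, transpose_mul,
      transpose_transpose]
    simpa [Matrix.mul_assoc] using h
  have h3 : R * Qᵀ = 0 := by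
    simpa using congrArg transpose h2
  calc Rᵀ * R * (Qᵀ * Q) = Rᵀ * (R * Qᵀ) * Q := by simp only [Matrix.mul_assoc]
    _ = 0 := by rw [h3]; simp

/-- The tangent-line (concavity) inequality for `log det`. -/
lemma logdet_le {n : ℕ} {A C : Matrix (Fin n) (Fin n) ℝ} (hA : A.PosDef) (hC : C.PosDef) :
    Real.log C.det ≤ Real.log A.det + (A⁻¹ * C).trace - n := by
  obtain ⟨R, hR⟩ := psd_factor hA.inv.posSemidef
  have hdetA := hA.det_pos
  have hdet : R.det * R.det = A.det⁻¹ := by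
    have := congrArg det hR
    rw [det_nonsing_inv, Ring.inverse_eq_inv', det_mul, det_transpose] at this
    exact this.symm
  have hR0 : R.det ≠ 0 := by
    intro h0; rw [h0] at hdet; simp at hdet; exact hdetA.ne' hdet.symm
  have hM := pd_conj hC R hR0
  have h1 : (R * C * Rᵀ).det = C.det / A.det := by
    rw [det_mul, det_mul, det_transpose, div_eq_mul_inv, ← hdet]; ring
  have h2 : (R * C * Rᵀ).trace = (A⁻¹ * C).trace := by
    rw [hR, trace_mul_cycle]
  have h3 := hM.1.det_eq_prod_eigenvalues
  have h4 := hM.1.trace_eq_sum_eigenvalues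
  have h5 : Real.log (R * C * Rᵀ).det ≤ (R * C * Rᵀ).trace - n := by
    rw [h3, h4]
    simp only [RCLike.ofReal_real_eq_id, id]
    rw [Real.log_prod (fun i _ => (hM.eigenvalues_pos i).ne')]
    calc _ ≤ ∑ i, (hM.1.eigenvalues i - 1) :=
          Finset.sum_le_sum fun i _ => Real.log_le_sub_one_of_pos (hM.eigenvalues_pos i)
      _ = _ := by simp
  rw [h1, h2, Real.log_div hC.det_pos.ne' hdetA.ne'] at h5
  linarith

lemma logdet_lt_add {n : ℕ} (hn : 0 < n) {A : Matrix (Fin n) (Fin n) ℝ} (hA : A.PosDef)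
    {c : ℝ} (hc : 0 < c) :
    Real.log A.det < Real.log (A + c • (1 : Matrix (Fin n) (Fin n) ℝ)).det := by
  have : Nonempty (Fin n) := ⟨⟨0, hn⟩⟩
  have h1 : (A + c • (1 : Matrix (Fin n) (Fin n) ℝ)).PosDef :=
    hA.add (PosDef.one.smul hc)
  set C := A + c • (1 : Matrix (Fin n) (Fin n) ℝ) with hCdef
  have h := logdet_le h1 hA
  have hAC : A = C - c • (1 : Matrix (Fin n) (Fin n) ℝ) := by rw [hCdef]; simp
  have h2 : (C⁻¹ * A).trace = n - c * (C⁻¹).trace := by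
    rw [hAC, Matrix.mul_sub, nonsing_inv_mul _ ((isUnit_iff_isUnit_det _).mp h1.isUnit)]
    simp [trace_sub]
  have := mul_pos hc h1.inv.trace_pos
  linarith

lemma psd_of_eig {n : ℕ} {A : Matrix (Fin n) (Fin n) ℝ} (hA : A.IsHermitian)
    (h : ∀ (e : ℝ) (v : Fin n → ℝ), v ≠ 0 → A *ᵥ v = e • v → 0 ≤ e) : A.PosSemidef := by
  rw [hA.posSemidef_iff_eigenvalues_nonneg]
  intro i
  refine h _ _ ?_ (hA.mulVec_eigenvectorBasis i)
  intro h0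
  have := hA.eigenvectorBasis.orthonormal.ne_zero i
  apply this
  ext j
  exact congrFun h0 j

lemma eig_pos {n : ℕ} {A : Matrix (Fin n) (Fin n) ℝ} (hA : A.PosDef) {e : ℝ} {v : Fin n → ℝ}
    (hv : v ≠ 0) (h : A *ᵥ v = e • v) : 0 < e := by
  have h1 := hA.dotProduct_mulVec_pos hv
  rw [h] at h1
  simp only [star_trivial, dotProduct_smul, smul_eq_mul] at h1
  have h2 : 0 ≤ v ⬝ᵥ v := by simpa using dotProduct_star_self_nonneg v
  exact pos_of_mul_pos_left h1 h2

lemma lambdaMin_isLeast {n : ℕ} (hn : 0 < n) {A : Matrix (Fin n) (Fin n) ℝ} (hA : A.PosDef) :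
    IsLeast {t : ℝ | ∃ v : Fin n → ℝ, v ≠ 0 ∧ A *ᵥ v = t • v} (lambdaMin A) := by
  have hfin : Set.Finite {t : ℝ | ∃ v : Fin n → ℝ, v ≠ 0 ∧ A *ᵥ v = t • v} := by
    refine (Module.End.finite_hasEigenvalue (Matrix.toLin' A)).subset ?_
    rintro t ⟨v, hv, h⟩
    exact Module.End.hasEigenvalue_of_hasEigenvector (x := v)
      (Module.End.hasEigenvector_iff.mpr ⟨Module.End.mem_eigenspace_iff.mpr (by simpa using h), hv⟩)
  have hne : Set.Nonempty {t : ℝ | ∃ v : Fin n → ℝ, v ≠ 0 ∧ A *ᵥ v = t • v} := by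
    refine ⟨hA.1.eigenvalues ⟨0, hn⟩, _, ?_, hA.1.mulVec_eigenvectorBasis ⟨0, hn⟩⟩
    intro h0
    apply hA.1.eigenvectorBasis.orthonormal.ne_zero ⟨0, hn⟩
    ext j
    exact congrFun h0 j
  exact ⟨hne.csInf_mem hfin, fun t ht => csInf_le hfin.bddBelow ht⟩

lemma trace_upper_zero {n : ℕ} {N D : Matrix (Fin n) (Fin n) ℝ}
    (hN : ∀ i j : Fin n, j < i → N i j = 0) (hD : ∀ i j : Fin n, i ≤ j → D i j = 0) :
    (N * Dᵀ).trace = 0 := by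
  simp only [trace, diag_apply, mul_apply, transpose_apply]
  refine Finset.sum_eq_zero fun i _ => Finset.sum_eq_zero fun j _ => ?_
  rcases lt_or_ge j i with h | h
  · rw [hN i j h, zero_mul]
  · rw [hD i j h, mul_zero]

lemma det_one_add {n : ℕ} {B : Matrix (Fin n) (Fin n) ℝ}
    (hB : ∀ i j : Fin n, i ≤ j → B i j = 0) : (1 + B).det = 1 := by
  rw [det_of_isLowerTriangular]
  · refine Finset.prod_eq_one fun i _ => ?_
    simp [hB i i le_rfl]
  · intro i j h
    have h : i < j := h
    simp [hB i j h.le, one_apply_ne h.ne]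

lemma upper_one_add {n : ℕ} {B : Matrix (Fin n) (Fin n) ℝ}
    (hB : ∀ i j : Fin n, i ≤ j → B i j = 0) : BlockTriangular (1 + B)ᵀ id := by
  intro i j h
  have h : j < i := h
  simp [hB j i h.le, one_apply_ne h.ne]

lemma upper_mul_iff {n : ℕ} {B N : Matrix (Fin n) (Fin n) ℝ}
    (hB : ∀ i j : Fin n, i ≤ j → B i j = 0) :
    (∀ i j : Fin n, j < i → (N * (1 + B)ᵀ : Matrix (Fin n) (Fin n) ℝ) i j = 0) ↔ (∀ i j : Fin n, j < i → N i j = 0) := by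
  have hu := upper_one_add hB
  have hd : IsUnit ((1 + B)ᵀ).det := by rw [det_transpose, det_one_add hB]; exact isUnit_one
  constructor
  · intro h
    have h1 : BlockTriangular (N * (1 + B)ᵀ) id := fun i j hij => h i j hij
    let _ := invertibleOfIsUnitDet _ hd
    have h2 := h1.mul (blockTriangular_inv_of_blockTriangular hu)
    rw [Matrix.mul_assoc, mul_nonsing_inv _ hd, Matrix.mul_one] at h2
    exact fun i j hij => h2 hij
  · intro h i j hij
    have h1 : BlockTriangular N id := fun i j hij => h i j hij
    exact h1.mul hu hij

lemma first_order_limit {n : ℕ} {Y H G : Matrix (Fin n) (Fin n) ℝ} (hY : Y.PosDef)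
    (h : ∀ᶠ t in nhdsWithin (0 : ℝ) (Set.Ioi 0), (Y + t • H + t ^ 2 • G).PosDef ∧
      Real.log (Y + t • H + t ^ 2 • G).det ≤ Real.log Y.det) : (Y⁻¹ * H).trace ≤ 0 := by
  have hc : ContinuousAt (fun t : ℝ => ((Y + t • H + t ^ 2 • G)⁻¹ * (H + t • G)).trace) 0 := by
    have hdet : ContinuousAt (fun t : ℝ => (Y + t • H + t ^ 2 • G)) 0 := by fun_prop
    have hinv : ContinuousAt (fun t : ℝ => (Y + t • H + t ^ 2 • G)⁻¹) 0 := by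
      have hi : ContinuousAt (Inv.inv : Matrix (Fin n) (Fin n) ℝ → _) Y := by
        refine continuousAt_matrix_inv Y ?_
        rw [Ring.inverse_eq_inv']
        exact continuousAt_inv₀ hY.det_pos.ne'
      exact ContinuousAt.comp_of_eq (g := Inv.inv) hi hdet (by simp)
    have h2 : ContinuousAt (fun t : ℝ => (Y + t • H + t ^ 2 • G)⁻¹ * (H + t • G)) 0 :=
      ContinuousAt.mul hinv
        (Continuous.continuousAt (by fun_prop : Continuous fun t : ℝ => H + t • G))
    have ht : Continuous (fun M : Matrix (Fin n) (Fin n) ℝ => M.trace) :=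
      Continuous.matrix_trace continuous_id
    exact ht.continuousAt.comp h2
  have hl := hc.tendsto.mono_left (nhdsWithin_le_nhds (s := Set.Ioi (0 : ℝ)))
  simp only [zero_smul, add_zero, ne_eq, OfNat.ofNat_ne_zero, not_false_eq_true, zero_pow] at hl
  refine le_of_tendsto hl ?_
  filter_upwards [h, self_mem_nhdsWithin] with t ht htpos
  have htpos : 0 < t := htpos
  obtain ⟨h1, h2⟩ := ht
  set C := Y + t • H + t ^ 2 • G with hC
  have h3 := logdet_le h1 hY
  have hYC : Y = C - t • (H + t • G) := by
    rw [hC, smul_add, smul_smul, pow_two]; abel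
  have h4 : (C⁻¹ * Y).trace = n - t * (C⁻¹ * (H + t • G)).trace := by
    nth_rewrite 1 [hYC]
    rw [Matrix.mul_sub, nonsing_inv_mul _ ((isUnit_iff_isUnit_det _).mp h1.isUnit), trace_sub,
      Matrix.mul_smul, trace_smul]
    simp
  have h5 : t * (C⁻¹ * (H + t • G)).trace ≤ 0 := by linarith
  exact nonpos_of_mul_nonpos_right h5 htpos

lemma ky_pd {n : ℕ} {K_Z K_V B : Matrix (Fin n) (Fin n) ℝ} (hKZ : K_Z.PosDef)
    (hKV : K_V.PosSemidef) (hB : ∀ i j : Fin n, i ≤ j → B i j = 0) :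
    (K_V + (1 + B) * K_Z * (1 + B)ᵀ).PosDef :=
  PosDef.posSemidef_add hKV (pd_conj hKZ _ (by rw [det_one_add hB]; exact one_ne_zero))

lemma trace_sym {n : ℕ} {K : Matrix (Fin n) (Fin n) ℝ} (hK : Kᵀ = K)
    (X Y : Matrix (Fin n) (Fin n) ℝ) : (X * K * Yᵀ).trace = (Y * K * Xᵀ).trace := by
  rw [← trace_transpose]
  simp [transpose_mul, hK, Matrix.mul_assoc]

lemma first_order {n : ℕ} {K_Z K_V B : Matrix (Fin n) (Fin n) ℝ} {P : ℝ}
    (hKZ : K_Z.PosDef) (hKV : K_V.PosSemidef)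
    (hB : ∀ i j : Fin n, i ≤ j → B i j = 0)
    (htr : (K_V + B * K_Z * Bᵀ).trace ≤ (n : ℝ) * P)
    (hmax : ∀ K_V' B' : Matrix (Fin n) (Fin n) ℝ, K_V'.PosSemidef →
        (∀ i j : Fin n, i ≤ j → B' i j = 0) →
        (K_V' + B' * K_Z * B'ᵀ).trace ≤ (n : ℝ) * P →
        Real.log (K_V' + (1 + B') * K_Z * (1 + B')ᵀ).det ≤
          Real.log (K_V + (1 + B) * K_Z * (1 + B)ᵀ).det)
    (hk : 0 < K_V.trace) {S : Matrix (Fin n) (Fin n) ℝ}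
    (hS : S = (K_V + (1 + B) * K_Z * (1 + B)ᵀ)⁻¹)
    {W D : Matrix (Fin n) (Fin n) ℝ} (hW : W.PosSemidef)
    (hD : ∀ i j : Fin n, i ≤ j → D i j = 0) :
    (S * W).trace + 2 * (S * (1 + B) * K_Z * Dᵀ).trace ≤
      (S * K_V).trace / K_V.trace * (W.trace + 2 * (B * K_Z * Dᵀ).trace) := by
  have hZs := psd_symm hKZ.1
  set κ := K_V.trace with hκ
  set a := (W.trace + 2 * (B * K_Z * Dᵀ).trace) / κ with ha
  set b := (D * K_Z * Dᵀ).trace / κ with hb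
  have hY := ky_pd hKZ hKV hB
  have hSs : Sᵀ = S := by rw [hS]; exact psd_symm hY.inv.1
  set Y := K_V + (1 + B) * K_Z * (1 + B)ᵀ with hYdef
  have key := first_order_limit (H := W - a • K_V + (1 + B) * K_Z * Dᵀ + D * K_Z * (1 + B)ᵀ)
    (G := D * K_Z * Dᵀ - b • K_V) hY ?_
  · rw [← hS] at key
    have e1 : (S * (D * K_Z * (1 + B)ᵀ)).trace = (S * ((1 + B) * K_Z * Dᵀ)).trace := by
      rw [← trace_transpose]
      rw [transpose_mul, hSs, trace_mul_comm]
      simp [transpose_mul, hZs, Matrix.mul_assoc]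
    simp only [Matrix.mul_add, Matrix.mul_sub, trace_add, trace_sub, Matrix.mul_smul, trace_smul,
      smul_eq_mul] at key e1
    simp only [Matrix.mul_add, Matrix.add_mul, trace_add, Matrix.mul_assoc] at key e1 ⊢
    have e2 : (S * K_V).trace / κ * (W.trace + 2 * (B * (K_Z * Dᵀ)).trace) =
        a * (S * K_V).trace := by
      rw [ha, Matrix.mul_assoc]; ring
    rw [e2]
    linarith
  · have hev : ∀ᶠ t in nhdsWithin (0 : ℝ) (Set.Ioi 0), 0 < 1 - (a * t + b * t ^ 2) := by
      have : ContinuousAt (fun t : ℝ => 1 - (a * t + b * t ^ 2)) 0 := by fun_prop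
      exact (this.eventually (lt_mem_nhds (by simp))).filter_mono nhdsWithin_le_nhds
    filter_upwards [hev, self_mem_nhdsWithin] with t ht htpos
    have htpos : 0 < t := htpos
    have hV' : ((1 - (a * t + b * t ^ 2)) • K_V + t • W).PosSemidef :=
      (hKV.smul ht.le).add (hW.smul htpos.le)
    have hB' : ∀ i j : Fin n, i ≤ j → (B + t • D) i j = 0 := by
      intro i j hij; simp [hB i j hij, hD i j hij]
    have hpath : Y + t • (W - a • K_V + (1 + B) * K_Z * Dᵀ + D * K_Z * (1 + B)ᵀ) +
        t ^ 2 • (D * K_Z * Dᵀ - b • K_V) = ((1 - (a * t + b * t ^ 2)) • K_V + t • W) +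
          (1 + (B + t • D)) * K_Z * (1 + (B + t • D))ᵀ := by
      rw [hYdef]
      simp only [transpose_add, transpose_smul, Matrix.mul_add, Matrix.add_mul, Matrix.mul_smul,
        Matrix.smul_mul]
      module
    rw [hpath]
    refine ⟨ky_pd hKZ hV' hB', hmax _ _ hV' hB' ?_⟩
    have e3 := trace_sym hZs D B
    have e4 : (((1 - (a * t + b * t ^ 2)) • K_V + t • W) +
        (B + t • D) * K_Z * (B + t • D)ᵀ).trace = (K_V + B * K_Z * Bᵀ).trace := by
      simp only [transpose_add, transpose_smul, Matrix.mul_add, Matrix.add_mul, Matrix.mul_smul,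
        Matrix.smul_mul, trace_add, trace_smul, smul_eq_mul, e3]
      rw [← hκ, ha, hb]
      field_simp
      ring
    rw [e4]; exact htr

/-- The algebraic identity linking the stationarity condition in `B` and orthogonality. -/
lemma stationarity_identity {n : ℕ} {K_Z K_V B S : Matrix (Fin n) (Fin n) ℝ} {ν : ℝ}
    (hSY : S * (K_V + (1 + B) * K_Z * (1 + B)ᵀ) = 1) (hSV : S * K_V = ν • K_V) :
    (S * (1 + B) * K_Z - ν • (B * K_Z)) * (1 + B)ᵀ =
      1 - ν • (K_V + B * K_Z * (1 + B)ᵀ) := by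
  rw [Matrix.mul_add, hSV] at hSY
  have h : S * ((1 + B) * K_Z * (1 + B)ᵀ) = 1 - ν • K_V :=
    eq_sub_of_add_eq' hSY
  simp only [Matrix.mul_assoc] at h
  rw [Matrix.sub_mul, Matrix.smul_mul, smul_add]
  simp only [Matrix.mul_assoc]
  rw [h]
  abel

lemma orth_iff {n : ℕ} {K_Z K_V B S : Matrix (Fin n) (Fin n) ℝ} {ν : ℝ} (hν : ν ≠ 0)
    (hB : ∀ i j : Fin n, i ≤ j → B i j = 0)
    (hSY : S * (K_V + (1 + B) * K_Z * (1 + B)ᵀ) = 1) (hSV : S * K_V = ν • K_V) :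
    (∀ i j : Fin n, j < i →
      (K_V + B * K_Z * (1 + B)ᵀ : Matrix (Fin n) (Fin n) ℝ) i j = 0) ↔
    (∀ i j : Fin n, j < i →
      (S * (1 + B) * K_Z - ν • (B * K_Z) : Matrix (Fin n) (Fin n) ℝ) i j = 0) := by
  rw [← upper_mul_iff (N := S * (1 + B) * K_Z - ν • (B * K_Z)) hB, stationarity_identity hSY hSV]
  refine forall_congr' fun i => forall_congr' fun j => forall_congr' fun hij => ?_
  rw [Matrix.sub_apply, Matrix.smul_apply, one_apply_ne hij.ne', zero_sub, neg_eq_zero, smul_eq_mul,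
    mul_eq_zero]
  simp [hν]

lemma necessity {n : ℕ} (hn : 0 < n) {K_Z K_V B : Matrix (Fin n) (Fin n) ℝ} {P : ℝ} (hP : 0 < P)
    (hKZ : K_Z.PosDef) (hKV : K_V.PosSemidef)
    (hB : ∀ i j : Fin n, i ≤ j → B i j = 0)
    (htr : (K_V + B * K_Z * Bᵀ).trace ≤ (n : ℝ) * P)
    (hmax : ∀ K_V' B' : Matrix (Fin n) (Fin n) ℝ, K_V'.PosSemidef →
        (∀ i j : Fin n, i ≤ j → B' i j = 0) →
        (K_V' + B' * K_Z * B'ᵀ).trace ≤ (n : ℝ) * P →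
        Real.log (K_V' + (1 + B') * K_Z * (1 + B')ᵀ).det ≤
          Real.log (K_V + (1 + B) * K_Z * (1 + B)ᵀ).det) :
    ((K_V + B * K_Z * Bᵀ).trace = (n : ℝ) * P ∧
        (K_V * ((K_V + (1 + B) * K_Z * (1 + B)ᵀ) -
          lambdaMin (K_V + (1 + B) * K_Z * (1 + B)ᵀ) •
            (1 : Matrix (Fin n) (Fin n) ℝ))).trace = 0 ∧
        (∀ i j : Fin n, j < i →
          ((K_V + B * K_Z * (1 + B)ᵀ : Matrix (Fin n) (Fin n) ℝ)) i j = 0)) := by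
  have hne : Nonempty (Fin n) := ⟨⟨0, hn⟩⟩
  have hn' : (0 : ℝ) < n := by exact_mod_cast hn
  have hY := ky_pd hKZ hKV hB
  refine ⟨?_, ?_⟩
  · by_contra hne
    have hlt := lt_of_le_of_ne htr hne
    set c := ((n : ℝ) * P - (K_V + B * K_Z * Bᵀ).trace) / n with hc
    have hcpos : 0 < c := div_pos (by linarith) hn'
    have h1 := hmax (K_V + c • (1 : Matrix (Fin n) (Fin n) ℝ)) B
      (hKV.add (PosSemidef.one.smul hcpos.le)) hB (by
        have : (c • (1 : Matrix (Fin n) (Fin n) ℝ)).trace =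
            (n : ℝ) * P - (K_V + B * K_Z * Bᵀ).trace := by
          rw [trace_smul, trace_one, hc]; simp; field_simp
        rw [add_right_comm, trace_add, this]; linarith)
    have h2 := logdet_lt_add hn hY hcpos
    rw [add_right_comm] at h1
    linarith
  have hV0 : K_V ≠ 0 := by
    intro h0
    have h1 := hmax (P • (1 : Matrix (Fin n) (Fin n) ℝ)) 0 (PosSemidef.one.smul hP.le)
      (by simp) (by simp [mul_comm])
    have h2 := logdet_lt_add hn hKZ hP
    have h3 : (K_V + (1 + B) * K_Z * (1 + B)ᵀ).det = K_Z.det := by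
      rw [h0, zero_add, det_mul, det_mul, det_transpose, det_one_add hB]; simp
    rw [h3] at h1
    simp only [add_zero, Matrix.one_mul, transpose_one, Matrix.mul_one] at h1
    rw [add_comm] at h1
    linarith
  have hk : 0 < K_V.trace := lt_of_le_of_ne hKV.trace_nonneg
    (fun h => hV0 (hKV.trace_eq_zero_iff.mp h.symm))
  have hfo := fun W D => first_order (W := W) (D := D) hKZ hKV hB htr hmax hk rfl
  set Y := K_V + (1 + B) * K_Z * (1 + B)ᵀ with hYdef
  have hSpd := hY.inv
  have hSY : Y⁻¹ * Y = 1 := nonsing_inv_mul _ ((isUnit_iff_isUnit_det _).mp hY.isUnit)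
  have hYS : Y * Y⁻¹ = 1 := mul_nonsing_inv _ ((isUnit_iff_isUnit_det _).mp hY.isUnit)
  set S := Y⁻¹ with hS
  set ν := (S * K_V).trace / K_V.trace with hν
  have hW : ∀ W : Matrix (Fin n) (Fin n) ℝ, W.PosSemidef → (S * W).trace ≤ ν * W.trace := by
    intro W hW
    simpa using hfo W 0 hW (by simp)
  have hνpos : 0 < ν := by
    have h1 := hW 1 PosSemidef.one
    rw [Matrix.mul_one, trace_one] at h1
    have h2 : 0 < S.trace := hSpd.trace_pos
    simp only [Fintype.card_fin] at h1
    exact pos_of_mul_pos_left (lt_of_lt_of_le h2 h1) hn'.le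
  have hνS : (ν • (1 : Matrix (Fin n) (Fin n) ℝ) - S).PosSemidef := by
    refine PosSemidef.of_dotProduct_mulVec_nonneg ?_ ?_
    · exact (isHermitian_one.smul (by simp [IsSelfAdjoint])).sub hSpd.1
    · intro x
      have h1 := hW (vecMulVec x x) (by simpa using posSemidef_vecMulVec_self_star x)
      rw [mul_vecMulVec, trace_vecMulVec, trace_vecMulVec] at h1
      simp only [star_trivial, Matrix.sub_mulVec, Matrix.smul_mulVec, Matrix.one_mulVec,
        dotProduct_sub, dotProduct_smul, smul_eq_mul]
      rw [dotProduct_comm x (S *ᵥ x)]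
      linarith
  have hz : (ν • (1 : Matrix (Fin n) (Fin n) ℝ) - S) * K_V = 0 := by
    refine trace_psd_mul_zero hνS hKV ?_
    rw [Matrix.sub_mul, trace_sub, Matrix.smul_mul, Matrix.one_mul, trace_smul, smul_eq_mul, hν]
    field_simp
    simp
  have hSV : S * K_V = ν • K_V := by
    rw [Matrix.sub_mul, Matrix.smul_mul, Matrix.one_mul, sub_eq_zero] at hz
    exact hz.symm
  have hYV : Y * K_V = ν⁻¹ • K_V := by
    have h1 := congrArg (fun M => ν⁻¹ • (Y * M)) hSV
    simp only [← Matrix.mul_assoc, hYS, Matrix.one_mul, Matrix.mul_smul, smul_smul,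
      inv_mul_cancel₀ hνpos.ne', one_smul] at h1
    exact h1.symm
  have hlam : lambdaMin Y = ν⁻¹ := by
    have hleast := lambdaMin_isLeast hn hY
    refine le_antisymm ?_ ?_
    · have : ∃ j, K_V.col j ≠ 0 := by
        by_contra hcon
        push Not at hcon
        apply hV0
        ext i j
        exact congrFun (hcon j) i
      obtain ⟨j, hj⟩ := this
      refine hleast.2 ⟨K_V.col j, hj, ?_⟩
      ext i
      have := congrFun (congrFun hYV i) j
      simpa [mul_apply, mulVec, dotProduct] using this
    · obtain ⟨v, hv, hev⟩ := hleast.1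
      have hpos := eig_pos hY hv hev
      have hSv : S *ᵥ v = (lambdaMin Y)⁻¹ • v := by
        have h1 : S *ᵥ (Y *ᵥ v) = v := by rw [mulVec_mulVec, hSY, one_mulVec]
        rw [hev, mulVec_smul] at h1
        nth_rewrite 2 [← h1]
        rw [smul_smul, inv_mul_cancel₀ hpos.ne', one_smul]
      have h2 := hνS.dotProduct_mulVec_nonneg v
      simp only [star_trivial, Matrix.sub_mulVec, Matrix.smul_mulVec, Matrix.one_mulVec,
        dotProduct_sub, dotProduct_smul, smul_eq_mul, hSv] at h2
      have h3 : 0 < v ⬝ᵥ v := by simpa using (dotProduct_star_self_pos_iff (v := v)).mpr hv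
      have h4 : (lambdaMin Y)⁻¹ ≤ ν := by
        by_contra hcon
        push Not at hcon
        nlinarith
      exact inv_le_of_inv_le₀ hpos h4
  refine ⟨?_, ?_⟩
  · rw [hlam, trace_mul_comm, Matrix.sub_mul, hYV]
    simp
  · rw [orth_iff hνpos.ne' hB hSY hSV]
    set N := S * (1 + B) * K_Z - ν • (B * K_Z) with hN
    intro i j hij
    set D : Matrix (Fin n) (Fin n) ℝ := single i j (N i j) with hD
    have h1 := hfo 0 D PosSemidef.zero (by
      intro i' j' hij'
      rw [hD, single_apply]
      rw [if_neg]
      rintro ⟨rfl, rfl⟩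
      exact absurd hij (not_lt.mpr hij'))
    have h2 : (N * Dᵀ).trace = N i j * N i j := by
      rw [hD, transpose_single, trace_mul_comm, trace_single_mul]
      simp
    have h3 : (N * Dᵀ).trace = (S * (1 + B) * K_Z * Dᵀ).trace - ν * (B * K_Z * Dᵀ).trace := by
      rw [hN, Matrix.sub_mul, trace_sub, Matrix.smul_mul, trace_smul, smul_eq_mul]
    simp only [Matrix.mul_zero, trace_zero, zero_add] at h1
    have h4 : N i j * N i j ≤ 0 := by rw [← h2, h3]; linarith
    exact mul_self_eq_zero.mp (le_antisymm h4 (mul_self_nonneg _))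

lemma sufficiency {n : ℕ} (hn : 0 < n) {K_Z K_V B : Matrix (Fin n) (Fin n) ℝ} {P : ℝ} 
    (hKZ : K_Z.PosDef) (hKV : K_V.PosSemidef)
    (hB : ∀ i j : Fin n, i ≤ j → B i j = 0)
    (hpow : (K_V + B * K_Z * Bᵀ).trace = (n : ℝ) * P)
    (hwf : (K_V * ((K_V + (1 + B) * K_Z * (1 + B)ᵀ) -
          lambdaMin (K_V + (1 + B) * K_Z * (1 + B)ᵀ) •
            (1 : Matrix (Fin n) (Fin n) ℝ))).trace = 0)
    (horth : ∀ i j : Fin n, j < i →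
          ((K_V + B * K_Z * (1 + B)ᵀ : Matrix (Fin n) (Fin n) ℝ)) i j = 0)
    (K_V' B' : Matrix (Fin n) (Fin n) ℝ) (hKV' : K_V'.PosSemidef)
    (hB' : ∀ i j : Fin n, i ≤ j → B' i j = 0)
    (htr' : (K_V' + B' * K_Z * B'ᵀ).trace ≤ (n : ℝ) * P) :
    Real.log (K_V' + (1 + B') * K_Z * (1 + B')ᵀ).det ≤
          Real.log (K_V + (1 + B) * K_Z * (1 + B)ᵀ).det := by
  have hY := ky_pd hKZ hKV hB
  have hY' := ky_pd hKZ hKV' hB'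
  have hZs := psd_symm hKZ.1
  have hlog := logdet_le hY hY'
  set Y := K_V + (1 + B) * K_Z * (1 + B)ᵀ with hYdef
  have hSpd := hY.inv
  have hSY : Y⁻¹ * Y = 1 := nonsing_inv_mul _ ((isUnit_iff_isUnit_det _).mp hY.isUnit)
  have hYS : Y * Y⁻¹ = 1 := mul_nonsing_inv _ ((isUnit_iff_isUnit_det _).mp hY.isUnit)
  set S := Y⁻¹ with hS
  have hSs : Sᵀ = S := psd_symm hSpd.1
  have hleast := lambdaMin_isLeast hn hY
  set l := lambdaMin Y with hl
  have hlpos : 0 < l := by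
    obtain ⟨v, hv, hev⟩ := hleast.1
    exact eig_pos hY hv hev
  have hYl : (Y - l • (1 : Matrix (Fin n) (Fin n) ℝ)).PosSemidef := by
    refine psd_of_eig (hY.1.sub (isHermitian_one.smul (by simp [IsSelfAdjoint]))) ?_
    intro e v hv hev
    rw [Matrix.sub_mulVec, Matrix.smul_mulVec, one_mulVec, sub_eq_iff_eq_add, ← add_smul] at hev
    have := hleast.2 ⟨v, hv, hev⟩
    linarith
  have hνS : (l⁻¹ • (1 : Matrix (Fin n) (Fin n) ℝ) - S).PosSemidef := by
    refine psd_of_eig ((isHermitian_one.smul (by simp [IsSelfAdjoint])).sub hSpd.1) ?_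
    intro e v hv hev
    have hev' : S *ᵥ v = (l⁻¹ - e) • v := by
      rw [Matrix.sub_mulVec, Matrix.smul_mulVec, one_mulVec] at hev
      rw [sub_smul, ← hev]; abel
    have hpos := eig_pos hSpd hv hev'
    have h1 : Y *ᵥ v = (l⁻¹ - e)⁻¹ • v := by
      have h2 : Y *ᵥ (S *ᵥ v) = v := by rw [mulVec_mulVec, hYS, one_mulVec]
      rw [hev', mulVec_smul] at h2
      nth_rewrite 2 [← h2]
      rw [smul_smul, inv_mul_cancel₀ hpos.ne', one_smul]
    have h3 : l ≤ (l⁻¹ - e)⁻¹ := hleast.2 ⟨v, hv, h1⟩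
    have h4 := (le_inv_comm₀ hlpos hpos).mp h3
    linarith
  have hz := trace_psd_mul_zero hKV hYl hwf
  have hYV : Y * K_V = l • K_V := by
    have h1 := congrArg transpose hz
    rw [transpose_mul, psd_symm hKV.1, psd_symm hYl.1, transpose_zero, Matrix.sub_mul,
      Matrix.smul_mul, Matrix.one_mul, sub_eq_zero] at h1
    exact h1
  set ν := l⁻¹ with hν
  have hνpos : 0 < ν := inv_pos.mpr hlpos
  have hSV : S * K_V = ν • K_V := by
    have h1 := congrArg (fun M => ν • (S * M)) hYV
    simp only [← Matrix.mul_assoc, hSY, Matrix.one_mul, Matrix.mul_smul, smul_smul] at h1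
    rw [hν, inv_mul_cancel₀ hlpos.ne', one_smul] at h1
    exact h1.symm
  have hstat := (orth_iff hνpos.ne' hB hSY hSV).mp horth
  have hW : ∀ W : Matrix (Fin n) (Fin n) ℝ, W.PosSemidef → (S * W).trace ≤ ν * W.trace := by
    intro W hW
    have := trace_psd_mul hνS hW
    rw [Matrix.sub_mul, trace_sub, Matrix.smul_mul, Matrix.one_mul, trace_smul, smul_eq_mul] at this
    linarith
  obtain ⟨D, rfl⟩ : ∃ D, B' = B + D := ⟨B' - B, by abel⟩
  have hD : ∀ i j : Fin n, i ≤ j → D i j = 0 := by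
    intro i j hij
    have := hB' i j hij
    rw [Matrix.add_apply, hB i j hij, zero_add] at this
    exact this
  have h1 := trace_upper_zero hstat hD
  rw [Matrix.sub_mul, trace_sub, Matrix.smul_mul, trace_smul, smul_eq_mul] at h1
  have h2 := hW _ hKV'
  have h3 := hW _ (psd_conj hKZ.posSemidef D)
  have e1 : (S * (D * K_Z * (1 + B)ᵀ)).trace = (S * (1 + B) * K_Z * Dᵀ).trace := by
    rw [← trace_transpose]
    rw [transpose_mul, hSs, trace_mul_comm]
    simp only [transpose_mul, hZs, Matrix.mul_assoc, transpose_transpose]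
  have e2 : K_V' + (1 + (B + D)) * K_Z * (1 + (B + D))ᵀ =
      K_V' + D * K_Z * Dᵀ + (Y - K_V) + (1 + B) * K_Z * Dᵀ + D * K_Z * (1 + B)ᵀ := by
    rw [hYdef]
    simp only [transpose_add, Matrix.mul_add, Matrix.add_mul]
    abel
  have e3 : (S * (K_V' + (1 + (B + D)) * K_Z * (1 + (B + D))ᵀ)).trace =
      (S * K_V').trace + (S * (D * K_Z * Dᵀ)).trace + (n - ν * K_V.trace) +
        2 * (S * (1 + B) * K_Z * Dᵀ).trace := by
    rw [e2]
    simp only [Matrix.mul_add S, Matrix.mul_sub S, trace_add, trace_sub, e1, hSY, hSV, trace_smul,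
      smul_eq_mul, trace_one, Fintype.card_fin]
    simp only [Matrix.mul_assoc, Matrix.mul_add, Matrix.add_mul, trace_add]
    ring
  have e4 := trace_sym hZs D B
  have e5 : (K_V' + (B + D) * K_Z * (B + D)ᵀ).trace = K_V'.trace + (B * K_Z * Bᵀ).trace +
      2 * (B * K_Z * Dᵀ).trace + (D * K_Z * Dᵀ).trace := by
    simp only [transpose_add, Matrix.mul_add, Matrix.add_mul, trace_add, e4]
    ring
  rw [trace_add] at hpow
  have h6 : ν * (K_V'.trace + (B * K_Z * Bᵀ).trace +
      2 * (B * K_Z * Dᵀ).trace + (D * K_Z * Dᵀ).trace) ≤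
      ν * (K_V.trace + (B * K_Z * Bᵀ).trace) := by
    rw [← e5, hpow]
    exact mul_le_mul_of_nonneg_left htr' hνpos.le
  rw [e3] at hlog
  linarith

/-- Characterization of the optimal `(K_V, B)` for the `n`-block
feedback Gaussian capacity: `(K_V, B)` maximizes
`log det(K_V' + (I+B') K_Z (I+B')ᵀ)` over psd `K_V'` and strictly lower triangular
`B'` with `tr(K_V' + B' K_Z B'ᵀ) ≤ nP` iff the power constraint is tight, `K_V`
water-fills `K_Y = K_V + (I+B) K_Z (I+B)ᵀ`, and `K_V + B K_Z (I+B)ᵀ` is upper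
triangular. -/
theorem stmt12 (n : ℕ) (K_Z K_V B : Matrix (Fin n) (Fin n) ℝ) (P : ℝ) (hP : 0 < P)
    (hKZ : K_Z.PosDef) (hKV : K_V.PosSemidef)
    (hB : ∀ i j : Fin n, i ≤ j → B i j = 0)
    (htr : (K_V + B * K_Z * Bᵀ).trace ≤ (n : ℝ) * P) :
    (∀ K_V' B' : Matrix (Fin n) (Fin n) ℝ, K_V'.PosSemidef →
        (∀ i j : Fin n, i ≤ j → B' i j = 0) →
        (K_V' + B' * K_Z * B'ᵀ).trace ≤ (n : ℝ) * P →
        Real.log (K_V' + (1 + B') * K_Z * (1 + B')ᵀ).det ≤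
          Real.log (K_V + (1 + B) * K_Z * (1 + B)ᵀ).det) ↔
      ((K_V + B * K_Z * Bᵀ).trace = (n : ℝ) * P ∧
        (K_V * ((K_V + (1 + B) * K_Z * (1 + B)ᵀ) -
          lambdaMin (K_V + (1 + B) * K_Z * (1 + B)ᵀ) •
            (1 : Matrix (Fin n) (Fin n) ℝ))).trace = 0 ∧
        (∀ i j : Fin n, j < i → ((K_V + B * K_Z * (1 + B)ᵀ : Matrix (Fin n) (Fin n) ℝ)) i j = 0)) := by
  rcases Nat.eq_zero_or_pos n with hn | hn
  · subst hn
    simp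
  · constructor
    · exact fun hmax => necessity hn hP hKZ hKV hB htr hmax
    · rintro ⟨h1, h2, h3⟩ K_V' B' hKV' hB' htr'
      exact sufficiency hn hKZ hKV hB h1 h2 h3 K_V' B' hKV' hB' htr'
end
end

section
/- Let K_Z be an n×n symmetric positive definite real matrix and P > 0, and suppose K_X* is a symmetric positive semidefinite matrix with tr K_X* ≤ nP attaining the n-block nonfeedback capacity C_n(K_Z,P). Then C_n(K_Z,P) = C_FB,n(K_Z,P) if and only if K_X* is diagonal. In particular, if K_Z is Toeplitz (stationary) and not diagonal (nonwhite), then C_n(K_Z,P) < C_FB,n(K_Z,P) for every n and every P > 0. -/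
open MeasureTheory Real Filter Matrix

noncomputable section

/-- The `n`-block nonfeedback capacity `C_n(K_Z, P)`. -/
def Cn {n : ℕ} (K_Z : Matrix (Fin n) (Fin n) ℝ) (P : ℝ) : ℝ :=
  sSup {c : ℝ | ∃ K_X : Matrix (Fin n) (Fin n) ℝ,
    K_X.PosSemidef ∧ K_X.trace ≤ (n : ℝ) * P ∧
    c = (1 / (2 * (n : ℝ))) * Real.log ((K_X + K_Z).det / K_Z.det)}

/-- The `n`-block feedback capacity `C_FB,n(K_Z, P)` of Cover–Pombra. -/
def CFBn {n : ℕ} (K_Z : Matrix (Fin n) (Fin n) ℝ) (P : ℝ) : ℝ :=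
  sSup {c : ℝ | ∃ K_V B : Matrix (Fin n) (Fin n) ℝ,
    K_V.PosSemidef ∧ (∀ i j : Fin n, i ≤ j → B i j = 0) ∧
    (K_V + B * K_Z * Bᵀ).trace ≤ (n : ℝ) * P ∧
    c = (1 / (2 * (n : ℝ))) *
          Real.log ((K_V + (1 + B) * K_Z * (1 + B)ᵀ).det / K_Z.det)}

open scoped MatrixOrder in
lemma aux_fact {n : ℕ} {A : Matrix (Fin n) (Fin n) ℝ} (hA : A.PosSemidef) :
    ∃ C : Matrix (Fin n) (Fin n) ℝ, A = Cᵀ * C := by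
  obtain ⟨B, hB⟩ := CStarAlgebra.nonneg_iff_eq_star_mul_self.mp hA.nonneg
  exact ⟨B, by rw [hB, star_eq_conjTranspose, conjTranspose_eq_transpose_of_trivial]⟩

lemma aux_conj {n : ℕ} {A : Matrix (Fin n) (Fin n) ℝ} (hA : A.PosSemidef)
    (B : Matrix (Fin n) (Fin n) ℝ) : (B * A * Bᵀ).PosSemidef := by
  simpa [conjTranspose_eq_transpose_of_trivial] using hA.mul_mul_conjTranspose_same B

lemma aux_logdet1 {n : ℕ} {A : Matrix (Fin n) (Fin n) ℝ} (hA : A.PosDef) :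
    Real.log A.det ≤ A.trace - n := by
  rw [hA.1.det_eq_prod_eigenvalues, hA.1.trace_eq_sum_eigenvalues]
  simp only [RCLike.ofReal_real_eq_id, id_eq]
  rw [Real.log_prod (fun i _ => (hA.eigenvalues_pos i).ne')]
  calc _ ≤ ∑ i, (hA.1.eigenvalues i - 1) :=
        Finset.sum_le_sum fun i _ => Real.log_le_sub_one_of_pos (hA.eigenvalues_pos i)
    _ = _ := by simp

lemma aux_logdet {n : ℕ} {A B : Matrix (Fin n) (Fin n) ℝ} (hA : A.PosDef) (hB : B.PosDef) :
    Real.log A.det - Real.log B.det ≤ (B⁻¹ * A).trace - n := by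
  obtain ⟨C, hC⟩ := aux_fact hB.inv.posSemidef
  have h2 : (C * A * Cᵀ).det = B.det⁻¹ * A.det := by
    have := congrArg det hC
    rw [det_nonsing_inv, Ring.inverse_eq_inv', det_mul, det_transpose] at this
    rw [this, det_mul, det_mul, det_transpose]; ring
  have hpd : (C * A * Cᵀ).PosDef := by
    rw [(aux_conj hA.posSemidef C).posDef_iff_det_ne_zero, h2]
    exact mul_ne_zero (inv_ne_zero hB.det_pos.ne') hA.det_pos.ne'
  have h3 := aux_logdet1 hpd
  rw [h2, Real.log_mul (inv_ne_zero hB.det_pos.ne') hA.det_pos.ne', Real.log_inv] at h3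
  have h4 : (C * A * Cᵀ).trace = (B⁻¹ * A).trace := by
    rw [hC, trace_mul_comm, Matrix.mul_assoc]
  linarith

lemma aux_deriv {n : ℕ} {S : Matrix (Fin n) (Fin n) ℝ} (hS : S.PosDef)
    (D E : Matrix (Fin n) (Fin n) ℝ)
    (h : ∀ᶠ e in nhdsWithin (0 : ℝ) (Set.Ioi 0), (S + e • D + e ^ 2 • E).PosDef ∧
      Real.log (S + e • D + e ^ 2 • E).det ≤ Real.log S.det) :
    (S⁻¹ * D).trace ≤ 0 := by
  have hc : ContinuousAt (fun e : ℝ => ((S + e • D + e ^ 2 • E)⁻¹ * (D + e • E)).trace) 0 := by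
    have h1 : ContinuousAt (fun e : ℝ => (S + e • D + e ^ 2 • E)⁻¹) 0 := by
      apply ContinuousAt.comp (f := fun e : ℝ => (S + e • D + e ^ 2 • E)) (g := Inv.inv)
      · apply continuousAt_matrix_inv
        rw [Ring.inverse_eq_inv']
        apply continuousAt_inv₀
        simpa using hS.det_pos.ne'
      · fun_prop
    have h2 : ContinuousAt (fun e : ℝ => D + e • E) 0 := by fun_prop
    have h3 : Continuous (fun p : Matrix (Fin n) (Fin n) ℝ => p.trace) := by fun_prop
    have h4 := h1.mul h2
    exact ContinuousAt.comp (g := fun p : Matrix (Fin n) (Fin n) ℝ => p.trace)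
      (f := fun e : ℝ => (S + e • D + e ^ 2 • E)⁻¹ * (D + e • E)) h3.continuousAt h4
  have ht : Tendsto (fun e : ℝ => ((S + e • D + e ^ 2 • E)⁻¹ * (D + e • E)).trace)
      (nhdsWithin (0 : ℝ) (Set.Ioi 0)) (nhds (S⁻¹ * D).trace) := by
    have := hc.tendsto.mono_left (nhdsWithin_le_nhds (s := Set.Ioi 0))
    simpa using this
  refine le_of_tendsto ht ?_
  filter_upwards [h, self_mem_nhdsWithin] with e he hpos
  obtain ⟨hM, hle⟩ := he
  have hpos : 0 < e := hpos
  set M := S + e • D + e ^ 2 • E with hMdef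
  have h1 := aux_logdet hS hM
  have h2 : e * (M⁻¹ * (D + e • E)).trace = n - (M⁻¹ * S).trace := by
    have : e • (D + e • E) = M - S := by
      rw [hMdef]; module
    rw [← smul_eq_mul, ← trace_smul, ← mul_smul_comm, this, Matrix.mul_sub,
      nonsing_inv_mul _ (isUnit_iff_ne_zero.mpr hM.det_pos.ne'), trace_sub, trace_one]
    simp
  have : e * (M⁻¹ * (D + e • E)).trace ≤ 0 := by linarith
  exact nonpos_of_mul_nonpos_right this hpos

/-- Water-filling optimality conditions. -/
lemma aux_kkt {n : ℕ} (hn : 0 < n) {S K : Matrix (Fin n) (Fin n) ℝ} (hS : S.PosDef)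
    (hK : K.PosSemidef) {P : ℝ} (hP : 0 < P) (htr : K.trace ≤ n * P)
    (h : ∀ X : Matrix (Fin n) (Fin n) ℝ, X.PosSemidef → X.trace ≤ n * P →
      (S⁻¹ * X).trace ≤ (S⁻¹ * K).trace) :
    ∃ μ : ℝ, 0 < μ ∧ (μ • (1 : Matrix (Fin n) (Fin n) ℝ) - S⁻¹).PosSemidef ∧
      (S⁻¹ * K).trace = μ * (n * P) ∧ S⁻¹ * K = μ • K := by
  have hnP : 0 < n * P := by positivity
  set t := (S⁻¹ * K).trace with ht
  have hv : ∀ v : Fin n → ℝ, v ⬝ᵥ (S⁻¹ *ᵥ v) ≤ t / (n * P) * (v ⬝ᵥ v) := by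
    intro v
    by_cases hv0 : v = 0
    · simp [hv0]
    have hvv : 0 < v ⬝ᵥ v := by
      have := dotProduct_star_self_pos_iff.mpr hv0
      simpa using this
    have h1 := h ((n * P / (v ⬝ᵥ v)) • vecMulVec v v)
      (by have := (posSemidef_vecMulVec_self_star v).smul (a := n * P / (v ⬝ᵥ v)) (by positivity)
          simpa using this)
      (by rw [trace_smul, trace_vecMulVec, smul_eq_mul]; field_simp; rfl)
    rw [mul_smul_comm, trace_smul, mul_vecMulVec, trace_vecMulVec, smul_eq_mul] at h1
    rw [div_mul_eq_mul_div, div_le_iff₀ hvv, dotProduct_comm] at h1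
    rw [div_mul_eq_mul_div, le_div_iff₀ hnP]
    linarith
  have hQ : ((t / (n * P)) • (1 : Matrix (Fin n) (Fin n) ℝ) - S⁻¹).PosSemidef := by
    refine PosSemidef.of_dotProduct_mulVec_nonneg ?_ ?_
    · refine IsHermitian.sub ?_ hS.inv.1
      ext i j; simp [one_apply, eq_comm]
    · intro x
      have := hv x
      simp [sub_mulVec, smul_mulVec]
      linarith
  have hμ : 0 < t / (n * P) := by
    have h1 := hQ.diag_nonneg (i := ⟨0, hn⟩)
    have h2 := hS.inv.diag_pos (i := ⟨0, hn⟩)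
    simp at h1
    linarith
  have hz : ((t / (n * P)) • (1 : Matrix (Fin n) (Fin n) ℝ) - S⁻¹) * K = 0 := by
    have htr0 : (((t / (n * P)) • (1 : Matrix (Fin n) (Fin n) ℝ) - S⁻¹) * K).trace ≤ 0 := by
      rw [Matrix.sub_mul, trace_sub, smul_mul_assoc, Matrix.one_mul, trace_smul, ← ht, smul_eq_mul]
      have := mul_le_mul_of_nonneg_left htr hμ.le
      rw [div_mul_cancel₀ _ hnP.ne'] at this
      linarith
    obtain ⟨C, hC⟩ := aux_fact hQ
    obtain ⟨D, hD⟩ := aux_fact hK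
    rw [hC, hD] at htr0 ⊢
    have he : (Cᵀ * C * (Dᵀ * D)).trace = ((C * Dᵀ) * (C * Dᵀ)ᵀ).trace := by
      rw [transpose_mul, transpose_transpose, Matrix.mul_assoc, trace_mul_comm]
      simp only [Matrix.mul_assoc]
    have hp := posSemidef_self_mul_conjTranspose (C * Dᵀ)
    rw [conjTranspose_eq_transpose_of_trivial] at hp
    have h0 := le_antisymm (he ▸ htr0) hp.trace_nonneg
    rw [← conjTranspose_eq_transpose_of_trivial (C * Dᵀ),
      trace_mul_conjTranspose_self_eq_zero_iff] at h0
    rw [Matrix.mul_assoc, ← Matrix.mul_assoc C, h0]; simp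
  refine ⟨t / (n * P), hμ, hQ, by field_simp, ?_⟩
  rw [Matrix.sub_mul, smul_mul_assoc, Matrix.one_mul, sub_eq_zero] at hz
  exact hz.symm

lemma aux_det_lower {n : ℕ} (B : Matrix (Fin n) (Fin n) ℝ)
    (hB : ∀ i j : Fin n, i ≤ j → B i j = 0) : (1 + B).det = 1 := by
  rw [det_of_isLowerTriangular]
  · refine Finset.prod_eq_one fun i _ => ?_
    simp [hB i i le_rfl]
  · intro i j hij
    have hij : i < j := hij
    simp [hB i j hij.le, hij.ne]

lemma aux_M_posDef {n : ℕ} {K V B : Matrix (Fin n) (Fin n) ℝ} (hK : K.PosDef)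
    (hV : V.PosSemidef) (hB : ∀ i j : Fin n, i ≤ j → B i j = 0) :
    (V + (1 + B) * K * (1 + B)ᵀ).PosDef := by
  refine PosDef.posSemidef_add hV ?_
  rw [(aux_conj hK.posSemidef (1 + B)).posDef_iff_det_ne_zero, det_mul, det_mul, det_transpose,
    aux_det_lower B hB]
  simpa using hK.det_pos.ne'

lemma aux_tr_bound {n : ℕ} {K V B : Matrix (Fin n) (Fin n) ℝ} (hK : K.PosDef)
    (hV : V.PosSemidef) :
    (V + (1 + B) * K * (1 + B)ᵀ).trace ≤ 2 * (V + B * K * Bᵀ).trace + 2 * K.trace := by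
  have h1 := (aux_conj hK.posSemidef (1 - B)).trace_nonneg
  have h2 := hV.trace_nonneg
  have h3 : (1 + B) * K * (1 + B)ᵀ + (1 - B) * K * (1 - B)ᵀ = (2 : ℝ) • K + (2 : ℝ) • (B * K * Bᵀ) := by
    simp only [transpose_add, transpose_sub, transpose_one, two_smul]
    noncomm_ring
  have h4 := congrArg trace h3
  simp only [trace_add, trace_smul, smul_eq_mul] at h4 ⊢
  linarith

lemma aux_bdd {n : ℕ} {K : Matrix (Fin n) (Fin n) ℝ} (hK : K.PosDef) (P : ℝ) :
    BddAbove {c : ℝ | ∃ K_V B : Matrix (Fin n) (Fin n) ℝ,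
    K_V.PosSemidef ∧ (∀ i j : Fin n, i ≤ j → B i j = 0) ∧
    (K_V + B * K * Bᵀ).trace ≤ (n : ℝ) * P ∧
    c = (1 / (2 * (n : ℝ))) *
          Real.log ((K_V + (1 + B) * K * (1 + B)ᵀ).det / K.det)} := by
  refine ⟨(1 / (2 * (n : ℝ))) * (2 * (n * P) + 2 * K.trace - n - Real.log K.det), ?_⟩
  rintro c ⟨V, B, hV, hB, htr, rfl⟩
  have hM := aux_M_posDef hK hV hB
  have h1 := aux_logdet1 hM
  have h2 := aux_tr_bound (B := B) hK hV
  rw [Real.log_div hM.det_pos.ne' hK.det_pos.ne']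
  gcongr
  linarith

lemma aux_le {n : ℕ} {K : Matrix (Fin n) (Fin n) ℝ} (hK : K.PosDef) {P : ℝ} (hP : 0 < P) :
    Cn K P ≤ CFBn K P := by
  unfold Cn CFBn
  apply csSup_le_csSup (aux_bdd hK P)
  · exact ⟨_, 0, PosSemidef.zero, by rw [trace_zero]; positivity, rfl⟩
  · rintro c ⟨X, hX, htr, rfl⟩
    exact ⟨X, 0, hX, by simp, by simpa using htr, by simp⟩

lemma aux_le_Cn {n : ℕ} {K : Matrix (Fin n) (Fin n) ℝ} (hK : K.PosDef) {P : ℝ}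
    {X : Matrix (Fin n) (Fin n) ℝ} (hX : X.PosSemidef) (htr : X.trace ≤ n * P) :
    (1 / (2 * (n : ℝ))) * Real.log ((X + K).det / K.det) ≤ Cn K P := by
  refine le_csSup ((aux_bdd hK P).mono ?_) ⟨X, hX, htr, rfl⟩
  rintro c ⟨X, hX, htr, rfl⟩
  exact ⟨X, 0, hX, by simp, by simpa using htr, by simp⟩

lemma aux_log {n : ℕ} (hn : 0 < n) {K A B : Matrix (Fin n) (Fin n) ℝ} (hK : K.PosDef)
    (hA : A.PosDef) (hB : B.PosDef) :
    (1 / (2 * (n : ℝ))) * Real.log (A.det / K.det) ≤ (1 / (2 * (n : ℝ))) * Real.log (B.det / K.det)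
     ↔ Real.log A.det ≤ Real.log B.det := by
  rw [Real.log_div hA.det_pos.ne' hK.det_pos.ne', Real.log_div hB.det_pos.ne' hK.det_pos.ne']
  have : 0 < 1 / (2 * (n : ℝ)) := by positivity
  rw [mul_le_mul_iff_right₀ this]
  constructor <;> intro h <;> linarith

/-- `tr (S⁻¹ B K_Z) = - μ tr (K_X B)` for traceless `B`. -/
lemma aux_cross {n : ℕ} {KZ KX B : Matrix (Fin n) (Fin n) ℝ} (hS : (KX + KZ).PosDef)
    (hKX : KX.PosSemidef) {μ : ℝ} (hμ : (KX + KZ)⁻¹ * KX = μ • KX)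
    (hB : ∀ i j : Fin n, i ≤ j → B i j = 0) :
    ((KX + KZ)⁻¹ * (B * KZ)).trace = - μ * (KX * B).trace := by
  have hu : IsUnit (KX + KZ).det := isUnit_iff_ne_zero.mpr hS.det_pos.ne'
  have h1 : KX * (KX + KZ)⁻¹ = μ • KX := by
    have := congrArg transpose hμ
    have e1 : KXᵀ = KX := by
      have := hKX.1.eq
      rwa [conjTranspose_eq_transpose_of_trivial] at this
    have e2 : ((KX + KZ)⁻¹)ᵀ = (KX + KZ)⁻¹ := by
      have := hS.inv.1.eq
      rwa [conjTranspose_eq_transpose_of_trivial] at this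
    rwa [transpose_mul, transpose_smul, e1, e2] at this
  have h2 : KZ * (KX + KZ)⁻¹ = 1 - μ • KX := by
    rw [← h1, ← mul_nonsing_inv _ hu, ← Matrix.sub_mul]; simp
  have h3 : B.trace = 0 := Finset.sum_eq_zero fun i _ => hB i i le_rfl
  rw [← Matrix.mul_assoc, trace_mul_comm, ← Matrix.mul_assoc, h2, Matrix.sub_mul, trace_sub,
    Matrix.one_mul, h3, smul_mul_assoc, trace_smul, smul_eq_mul]
  ring

lemma aux_expand {n : ℕ} {S K V B : Matrix (Fin n) (Fin n) ℝ} (hS : S.PosDef) (hK : K.PosDef) :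
    (S⁻¹ * (V + (1 + B) * K * (1 + B)ᵀ)).trace = (S⁻¹ * (V + B * K * Bᵀ)).trace
      + 2 * (S⁻¹ * (B * K)).trace + (S⁻¹ * K).trace := by
  have e1 : Kᵀ = K := by
    have := hK.1.eq
    rwa [conjTranspose_eq_transpose_of_trivial] at this
  have e2 : (S⁻¹)ᵀ = S⁻¹ := by
    have := hS.inv.1.eq
    rwa [conjTranspose_eq_transpose_of_trivial] at this
  have h1 : (S⁻¹ * (K * Bᵀ)).trace = (S⁻¹ * (B * K)).trace := by
    rw [← trace_transpose, transpose_mul, transpose_mul, transpose_transpose, e1, e2,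
      trace_mul_comm]
  have h2 : S⁻¹ * (V + (1 + B) * K * (1 + B)ᵀ) = S⁻¹ * (V + B * K * Bᵀ) + S⁻¹ * (B * K)
      + S⁻¹ * (K * Bᵀ) + S⁻¹ * K := by
    simp only [transpose_add, transpose_one]
    noncomm_ring
  rw [h2, trace_add, trace_add, trace_add, h1]
  ring

/-- `Q ≥ 0`, `X ≥ 0` implies `tr (Q X) ≥ 0`. -/
lemma aux_tr_nonneg {n : ℕ} {Q X : Matrix (Fin n) (Fin n) ℝ} (hQ : Q.PosSemidef)
    (hX : X.PosSemidef) : 0 ≤ (Q * X).trace := by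
  obtain ⟨C, hC⟩ := aux_fact hQ
  rw [hC, Matrix.mul_assoc, trace_mul_comm]
  exact (aux_conj hX C).trace_nonneg

lemma aux_diag_imp {n : ℕ} (hn : 0 < n) {KZ KX : Matrix (Fin n) (Fin n) ℝ} (hKZ : KZ.PosDef)
    {P : ℝ} (hKX : KX.PosSemidef) {μ : ℝ} (hμ0 : 0 < μ)
    (hQ : (μ • (1 : Matrix (Fin n) (Fin n) ℝ) - (KX + KZ)⁻¹).PosSemidef)
    (ht : ((KX + KZ)⁻¹ * KX).trace = μ * (n * P)) (hμ : (KX + KZ)⁻¹ * KX = μ • KX)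
    (hP : 0 < P) (hd : KX.IsDiag) :
    CFBn KZ P ≤ (1 / (2 * (n : ℝ))) * Real.log ((KX + KZ).det / KZ.det) := by
  have hS : (KX + KZ).PosDef := PosDef.posSemidef_add hKX hKZ
  have hu : IsUnit (KX + KZ).det := isUnit_iff_ne_zero.mpr hS.det_pos.ne'
  unfold CFBn
  apply csSup_le
  · exact ⟨_, 0, 0, PosSemidef.zero, by simp, by simp; positivity, rfl⟩
  rintro c ⟨V, B, hV, hB, htr, rfl⟩
  have hM := aux_M_posDef hKZ hV hB
  rw [aux_log hn hKZ hM hS]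
  have h1 := aux_logdet hM hS
  rw [aux_expand hS hKZ, aux_cross hS hKX hμ hB] at h1
  have h2 : (KX * B).trace = 0 := by
    refine Finset.sum_eq_zero fun i _ => ?_
    rw [diag_apply, mul_apply]
    refine Finset.sum_eq_zero fun j _ => ?_
    by_cases hij : i = j
    · subst hij; simp [hB i i le_rfl]
    · rw [hd hij, zero_mul]
  have h3 := aux_tr_nonneg hQ (hV.add (aux_conj hKZ.posSemidef B))
  rw [Matrix.sub_mul, trace_sub, smul_mul_assoc, Matrix.one_mul, trace_smul, smul_eq_mul] at h3
  have h4 := mul_le_mul_of_nonneg_left htr hμ0.le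
  have h5 : ((KX + KZ)⁻¹ * KX).trace + ((KX + KZ)⁻¹ * KZ).trace = n := by
    rw [← trace_add, ← Matrix.mul_add, nonsing_inv_mul _ hu]; simp
  rw [h2] at h1
  linarith

lemma aux_imp_diag {n : ℕ} (hn : 0 < n) {KZ KX : Matrix (Fin n) (Fin n) ℝ} (hKZ : KZ.PosDef)
    {P : ℝ} (hKX : KX.PosSemidef) {μ : ℝ} (hμ0 : 0 < μ)
    (hμ : (KX + KZ)⁻¹ * KX = μ • KX)
    (hP : 0 < P) (htr : KX.trace ≤ n * P)
    (hle : CFBn KZ P ≤ (1 / (2 * (n : ℝ))) * Real.log ((KX + KZ).det / KZ.det)) :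
    KX.IsDiag := by
  have hS : (KX + KZ).PosDef := PosDef.posSemidef_add hKX hKZ
  have hnP : 0 < n * P := by positivity
  have key : ∀ B : Matrix (Fin n) (Fin n) ℝ, (∀ i j : Fin n, i ≤ j → B i j = 0) →
      0 ≤ (KX * B).trace := by
    intro B hB
    set c := (B * KZ * Bᵀ).trace with hc
    have hc0 : 0 ≤ c := (aux_conj hKZ.posSemidef B).trace_nonneg
    have h1 := aux_deriv hS (B * KZ + KZ * Bᵀ) (B * KZ * Bᵀ - (c / (n * P)) • KX) (by
      have hev : ∀ᶠ e in nhdsWithin (0 : ℝ) (Set.Ioi 0), e ^ 2 * (c / (n * P)) < 1 := by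
        have : ContinuousAt (fun e : ℝ => e ^ 2 * (c / (n * P))) 0 := by fun_prop
        refine (this.tendsto.mono_left nhdsWithin_le_nhds).eventually_lt_const ?_
        simp
      filter_upwards [hev] with e he
      have hV : ((1 - e ^ 2 * (c / (n * P))) • KX).PosSemidef := hKX.smul (by linarith)
      have heB : ∀ i j : Fin n, i ≤ j → (e • B) i j = 0 := by
        intro i j hij; simp [hB i j hij]
      have hEq : KX + KZ + e • (B * KZ + KZ * Bᵀ) + e ^ 2 • (B * KZ * Bᵀ - (c / (n * P)) • KX)
          = (1 - e ^ 2 * (c / (n * P))) • KX + (1 + e • B) * KZ * (1 + e • B)ᵀ := by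
        simp only [transpose_add, transpose_one, transpose_smul, Matrix.add_mul, Matrix.mul_add,
          Matrix.one_mul, Matrix.mul_one, smul_mul_assoc, mul_smul_comm]
        module
      have hM := aux_M_posDef hKZ hV heB
      rw [hEq]
      refine ⟨hM, ?_⟩
      rw [← aux_log hn hKZ hM hS]
      refine le_trans (le_csSup (aux_bdd hKZ P) ⟨_, _, hV, heB, ?_, rfl⟩) hle
      have : (e • B) * KZ * (e • B)ᵀ = e ^ 2 • (B * KZ * Bᵀ) := by
        rw [transpose_smul, smul_mul_assoc, smul_mul_assoc, mul_smul_comm, smul_smul, sq]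
      rw [this, trace_add, trace_smul, trace_smul, ← hc, smul_eq_mul, smul_eq_mul]
      have h6 := mul_le_mul_of_nonneg_left htr (by linarith : 0 ≤ 1 - e ^ 2 * (c / (n * P)))
      have h7 : (1 - e ^ 2 * (c / (n * P))) * (n * P) = n * P - e ^ 2 * c := by
        field_simp
      linarith)
    have h2 := aux_expand (V := 0) (B := B) hS hKZ
    have h3 : (0 : Matrix (Fin n) (Fin n) ℝ) + (1 + B) * KZ * (1 + B)ᵀ
        = (B * KZ + KZ * Bᵀ) + (0 + B * KZ * Bᵀ) + KZ := by
      simp only [transpose_add, transpose_one]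
      noncomm_ring
    rw [h3, Matrix.mul_add, Matrix.mul_add, trace_add, trace_add, aux_cross hS hKX hμ hB] at h2
    have h4 : 0 ≤ μ * (KX * B).trace := by linarith
    exact nonneg_of_mul_nonneg_right h4 hμ0
  have hlow : ∀ i j : Fin n, j < i → KX j i = 0 := by
    intro i j hij
    have hs : ∀ a : ℝ, 0 ≤ KX j i * a := by
      intro a
      have := key (single i j a) (by
        intro k l hkl
        rw [single_apply, if_neg]
        rintro ⟨rfl, rfl⟩
        exact absurd hkl (not_le.mpr hij))
      rwa [trace_mul_single] at this
    have h1 := hs 1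
    have h2 := hs (-1)
    linarith
  intro i j hij
  rcases lt_or_gt_of_ne hij with h | h
  · exact hlow j i h
  · have := hKX.1.apply i j
    rw [← this, hlow i j h]; simp

lemma aux_toeplitz {n : ℕ} (hn : 0 < n) {KZ KX : Matrix (Fin n) (Fin n) ℝ} (hKZ : KZ.PosDef)
    {P : ℝ} (hKX : KX.PosSemidef) {μ : ℝ} (hμ0 : 0 < μ)
    (hQ : (μ • (1 : Matrix (Fin n) (Fin n) ℝ) - (KX + KZ)⁻¹).PosSemidef)
    (ht : ((KX + KZ)⁻¹ * KX).trace = μ * (n * P)) (hμ : (KX + KZ)⁻¹ * KX = μ • KX)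
    (hP : 0 < P) (hd : KX.IsDiag)
    (hT : ∀ i j : Fin n, KZ i i = KZ j j) : KZ.IsDiag := by
  have hS : (KX + KZ).PosDef := PosDef.posSemidef_add hKX hKZ
  have hu : IsUnit (KX + KZ).det := isUnit_iff_ne_zero.mpr hS.det_pos.ne'
  have h1 : KX = μ • ((KX + KZ) * KX) := by
    rw [← mul_smul_comm, ← hμ, ← Matrix.mul_assoc, mul_nonsing_inv _ hu, Matrix.one_mul]
  have h2 : ∀ i j, KX i j = μ * ((KX i j + KZ i j) * KX j j) := by
    intro i j
    have := congrFun (congrFun h1 i) j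
    rw [Matrix.smul_apply, mul_apply, Finset.sum_eq_single j, smul_eq_mul, Matrix.add_apply] at this
    · exact this
    · intro k _ hk; rw [hd hk, mul_zero]
    · simp
  have h3 : ∀ i, 1 / μ ≤ KX i i + KZ i i := by
    intro i
    have ha : ((KX + KZ - (1 / μ) • 1) * (KX + KZ)⁻¹ * (KX + KZ - (1 / μ) • 1)ᵀ).PosSemidef :=
      aux_conj hS.inv.posSemidef _
    have e1 : (KX + KZ - (1 / μ) • 1)ᵀ = KX + KZ - (1 / μ) • 1 := by
      have := hS.1.eq
      rw [conjTranspose_eq_transpose_of_trivial] at this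
      rw [transpose_sub, this]; simp
    have e2 : (KX + KZ - (1 / μ) • 1) * (KX + KZ)⁻¹ * (KX + KZ - (1 / μ) • 1)
        = (KX + KZ) - (2 / μ) • 1 + (1 / μ) ^ 2 • (KX + KZ)⁻¹ := by
      rw [Matrix.sub_mul, mul_nonsing_inv _ hu, smul_mul_assoc, Matrix.one_mul, Matrix.sub_mul,
        Matrix.one_mul, Matrix.mul_sub, smul_mul_assoc, nonsing_inv_mul _ hu, mul_smul_comm,
        Matrix.mul_one]
      module
    rw [e1, e2] at ha
    have hb := ha.diag_nonneg (i := i)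
    have hc := hQ.diag_nonneg (i := i)
    simp at hb hc
    have hd' : (μ ^ 2)⁻¹ * (KX + KZ)⁻¹ i i ≤ (μ ^ 2)⁻¹ * μ := by
      gcongr
    have : (μ ^ 2)⁻¹ * μ = 1 / μ := by field_simp
    have : 2 / μ = 1 / μ + 1 / μ := by ring
    linarith
  have hne : ∃ j, KX j j ≠ 0 := by
    by_contra! hcon
    have : KX = 0 := by
      ext i j
      by_cases hij : i = j
      · subst hij; simp [hcon]
      · simp [hd hij]
    rw [this] at ht
    simp at ht
    rcases ht with h | h | h
    · exact hμ0.ne' h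
    · omega
    · exact hP.ne' h
  have hval : ∀ j, KX j j ≠ 0 → KX j j + KZ j j = 1 / μ := by
    intro j hj
    have := h2 j j
    have h5 : (μ * (KX j j + KZ j j) - 1) * KX j j = 0 := by linarith
    rcases mul_eq_zero.mp h5 with h | h
    · field_simp; linarith
    · exact absurd h hj
  obtain ⟨j0, hj0⟩ := hne
  have hall : ∀ i, KX i i ≠ 0 := by
    intro i hi
    have a1 := h3 i
    have a2 := hval j0 hj0
    have a3 := hT i j0
    have a4 : 0 ≤ KX j0 j0 := hKX.diag_nonneg
    rw [hi, zero_add, a3] at a1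
    exact hj0 (le_antisymm (by linarith) a4)
  intro i j hij
  have := h2 i j
  rw [hd hij, zero_add] at this
  have h6 := mul_eq_zero.mp this.symm
  rcases h6 with h | h
  · exact absurd h hμ0.ne'
  · exact (mul_eq_zero.mp h).resolve_right (hall j)

/-- **Baker–Ihara–Yanagi.** If `K_X*` attains the `n`-block
nonfeedback capacity, then feedback does not increase the `n`-block capacity iff
`K_X*` is diagonal; in particular, for a Toeplitz (stationary) nondiagonal (nonwhite)
`K_Z`, feedback strictly increases the `n`-block capacity. -/
theorem stmt15 (n : ℕ) (K_Z : Matrix (Fin n) (Fin n) ℝ) (hKZ : K_Z.PosDef)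
    (P : ℝ) (hP : 0 < P)
    (K_X : Matrix (Fin n) (Fin n) ℝ) (hKX : K_X.PosSemidef)
    (htr : K_X.trace ≤ (n : ℝ) * P)
    (hatt : (1 / (2 * (n : ℝ))) * Real.log ((K_X + K_Z).det / K_Z.det) = Cn K_Z P) :
    (Cn K_Z P = CFBn K_Z P ↔ K_X.IsDiag) ∧
    ((∀ i j i' j' : Fin n, (i : ℤ) - (j : ℤ) = (i' : ℤ) - (j' : ℤ) →
        K_Z i j = K_Z i' j') → ¬ K_Z.IsDiag → Cn K_Z P < CFBn K_Z P) := by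
  rcases Nat.eq_zero_or_pos n with rfl | hn
  · have hX : K_X.IsDiag := fun i => i.elim0
    have hZ : K_Z.IsDiag := fun i => i.elim0
    refine ⟨⟨fun _ => hX, fun _ => ?_⟩, fun _ h => absurd hZ h⟩
    refine le_antisymm (aux_le hKZ hP) ?_
    rw [← hatt]
    refine csSup_le ⟨_, 0, 0, PosSemidef.zero, by simp, by simp, rfl⟩ ?_
    rintro c ⟨V, B, -, -, -, rfl⟩
    simp
  have hS : (K_X + K_Z).PosDef := PosDef.posSemidef_add hKX hKZ
  obtain ⟨μ, hμ0, hQ, ht, hμ⟩ := aux_kkt hn hS hKX hP htr (by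
    intro X hX hXtr
    have h1 := aux_deriv hS (X - K_X) 0 (by
      have hev : ∀ᶠ e in nhdsWithin (0 : ℝ) (Set.Ioi 0), e < 1 :=
        nhdsWithin_le_nhds (eventually_lt_nhds one_pos)
      filter_upwards [hev, self_mem_nhdsWithin] with e he he0
      have he0 : 0 < e := he0
      have hY : ((1 - e) • K_X + e • X).PosSemidef :=
        (hKX.smul (by linarith)).add (hX.smul he0.le)
      have hEq : K_X + K_Z + e • (X - K_X) + e ^ 2 • (0 : Matrix (Fin n) (Fin n) ℝ)
          = ((1 - e) • K_X + e • X) + K_Z := by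
        module
      have hM : (((1 - e) • K_X + e • X) + K_Z).PosDef := PosDef.posSemidef_add hY hKZ
      rw [hEq]
      refine ⟨hM, ?_⟩
      rw [← aux_log hn hKZ hM hS, hatt]
      refine aux_le_Cn hKZ hY ?_
      rw [trace_add, trace_smul, trace_smul, smul_eq_mul, smul_eq_mul]
      nlinarith)
    rw [Matrix.mul_sub, trace_sub] at h1
    linarith)
  have hiff : Cn K_Z P = CFBn K_Z P ↔ K_X.IsDiag := by
    constructor
    · intro h
      exact aux_imp_diag hn hKZ hKX hμ0 hμ hP htr (by rw [hatt, h])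
    · intro h
      refine le_antisymm (aux_le hKZ hP) ?_
      rw [← hatt]
      exact aux_diag_imp hn hKZ hKX hμ0 hQ ht hμ hP h
  refine ⟨hiff, fun hT hnd => lt_of_le_of_ne (aux_le hKZ hP) fun h => hnd ?_⟩
  exact aux_toeplitz hn hKZ hKX hμ0 hQ ht hμ hP (hiff.mp h) (fun i j => hT i i j j (by simp))
end
end
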